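/- arXiv:2506.12740 — 2 statements merged into one kernel-verified Lean document; each statement's English description precedes it below -/
import Mathlib

section
/- Let T be a tree of order n that attains the second-largest number of dissociation sets among all trees of order n (i.e., T maximizes d among all trees of order n that do not attain the maximum value of d over trees of order n). If a quasi-pendant vertex u_q of T is adjacent to s pendant vertices, then s ≤ 3. -/
open SimpleGraph

/-- `S` is a dissociation set of `G`: every vertex of `S` has at most one neighbor in `S`. -/
def IsDissociation {V : Type*} (G : SimpleGraph V) (S : Set V) : Prop :=
  ∀ v ∈ S, (G.neighborSet v ∩ S).Subsingleton

/-- `d(G)`: the number of dissociation sets of `G`. -/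
noncomputable def dissocNum {V : Type*} (G : SimpleGraph V) : ℕ :=
  Nat.card {S : Set V // IsDissociation G S}

/-- `K_{r+1} ∗ (K_{s₀+1} ∪ ⋯ ∪ K_{sₜ+1})`: the hub `Sum.inl 0` of the complete graph
`K_{r+1}` is joined to the vertex `0` of each complete component. -/
def starGraph (r : ℕ) (s : List ℕ) :
    SimpleGraph (Fin (r + 1) ⊕ (Σ i : Fin s.length, Fin (s.get i + 1))) where
  Adj x y := x ≠ y ∧
    (Sum.elim (fun _ => (none : Option (Fin s.length))) (fun p => some p.1) x =
        Sum.elim (fun _ => (none : Option (Fin s.length))) (fun p => some p.1) y ∨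
      (x = Sum.inl 0 ∧ ∃ i, y = Sum.inr ⟨i, 0⟩) ∨
      (y = Sum.inl 0 ∧ ∃ i, x = Sum.inr ⟨i, 0⟩))
  symm := by
    refine ⟨?_⟩
    rintro x y ⟨h1, h2⟩
    refine ⟨h1.symm, ?_⟩
    rcases h2 with h | h | h
    · exact Or.inl h.symm
    · exact Or.inr (Or.inr h)
    · exact Or.inr (Or.inl h)
  loopless := ⟨fun x h => h.1 rfl⟩

/-- `T` attains the second-largest number of dissociation sets among all trees of order `n`:
`T` is a tree of order `n` that does not attain the maximum of `d` over trees of order `n`,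
and `d(T)` is largest among such trees. -/
def SecondLargestTree (n : ℕ) (T : SimpleGraph (Fin n)) : Prop :=
  T.IsTree ∧
  (∃ T' : SimpleGraph (Fin n), T'.IsTree ∧ dissocNum T < dissocNum T') ∧
  (∀ T' : SimpleGraph (Fin n), T'.IsTree →
    (∃ T'' : SimpleGraph (Fin n), T''.IsTree ∧ dissocNum T' < dissocNum T'') →
    dissocNum T' ≤ dissocNum T)

/-- The graph obtained from `G` by replacing the edge `ub` by the edge `ab`. -/
def reattach {V : Type*} (G : SimpleGraph V) (u a b : V) : SimpleGraph V :=
  (G \ edge u b) ⊔ edge a b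

theorem reattach_adj {V : Type*} (G : SimpleGraph V) {u a b : V} (hub : u ≠ b) (hab : a ≠ b)
    (x y : V) : (reattach G u a b).Adj x y ↔
      (G.Adj x y ∧ ¬ (x = u ∧ y = b) ∧ ¬ (x = b ∧ y = u)) ∨ (x = a ∧ y = b) ∨ (x = b ∧ y = a) := by
  simp only [reattach, sup_adj, sdiff_adj, edge_adj]
  grind

theorem reattach_isTree {V : Type*} {G : SimpleGraph V} (hG : G.IsTree) {u a b : V}
    (ha : G.neighborSet a = {u}) (hb : G.neighborSet b = {u}) (hab : a ≠ b) :
    (reattach G u a b).IsTree := by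
  have hau : G.Adj a u := by simpa using (Set.ext_iff.1 ha u).2 rfl
  have hbu : G.Adj b u := by simpa using (Set.ext_iff.1 hb u).2 rfl
  have hb' : ∀ y, G.Adj b y → y = u := fun y hy => (Set.ext_iff.1 hb y).1 hy
  have adj := reattach_adj G hbu.ne' hab
  have hua : (reattach G u a b).Adj u a := (adj u a).2 (Or.inl ⟨hau.symm, by grind, by grind⟩)
  have hab' : (reattach G u a b).Adj a b := (adj a b).2 (by grind)
  have hreach : ∀ x y, G.Adj x y → (reattach G u a b).Reachable x y := by
    intro x y h
    by_cases h1 : x = u ∧ y = b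
    · rw [h1.1, h1.2]
      exact hua.reachable.trans hab'.reachable
    by_cases h2 : x = b ∧ y = u
    · rw [h2.1, h2.2]
      exact (hua.reachable.trans hab'.reachable).symm
    exact ((adj x y).2 (Or.inl ⟨h, h1, h2⟩)).reachable
  have : Nonempty V := ⟨u⟩
  refine ⟨⟨fun x y => ?_⟩, ?_⟩
  · obtain ⟨w⟩ := hG.1.preconnected x y
    induction w with
    | nil => rfl
    | cons h _ ih => exact (hreach _ _ h).trans ih
  · refine (isAcyclic_add_edge_iff_of_not_reachable a b ?_).2 (hG.2.anti sdiff_le)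
    intro h
    obtain ⟨w⟩ := h.symm
    cases w with
    | nil => exact hab rfl
    | cons h _ =>
      rw [sdiff_adj, edge_adj] at h
      have := hb' _ h.1
      grind [hbu.ne]

theorem dissocNum_lt_reattach {V : Type*} [Finite V] {G : SimpleGraph V} {u a b x : V}
    (ha : G.neighborSet a = {u}) (hb : G.neighborSet b = {u}) (hab : a ≠ b)
    (hux : G.Adj u x) (hxa : x ≠ a) (hxb : x ≠ b) :
    dissocNum G < dissocNum (reattach G u a b) := by
  have hau : G.Adj a u := by simpa using (Set.ext_iff.1 ha u).2 rfl
  have hbu : G.Adj b u := by simpa using (Set.ext_iff.1 hb u).2 rfl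
  have ha' : ∀ y, G.Adj a y → y = u := fun y hy => (Set.ext_iff.1 ha y).1 hy
  have hb' : ∀ y, G.Adj b y → y = u := fun y hy => (Set.ext_iff.1 hb y).1 hy
  have adj := reattach_adj G hbu.ne' hab
  have hsub : {S : Set V | IsDissociation G S} ⊆ {S | IsDissociation (reattach G u a b) S} := by
    intro S hS v hv y hy z hz
    have hu : a ∈ S → b ∈ S → u ∉ S := fun h1 h2 h3 =>
      hab (hS u h3 ⟨hau.symm, h1⟩ ⟨hbu.symm, h2⟩)
    have hG : G.Adj v y → G.Adj v z → y = z := fun h1 h2 => hS v hv ⟨h1, hy.2⟩ ⟨h2, hz.2⟩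
    have hy1 := (adj v y).1 hy.1
    have hz1 := (adj v z).1 hz.1
    have hyS := hy.2
    have hzS := hz.2
    grind
  have hlt : {S : Set V | IsDissociation G S} ⊂ {S | IsDissociation (reattach G u a b) S} := by
    refine ⟨hsub, fun h => ?_⟩
    have hmem : IsDissociation (reattach G u a b) {u, x, b} := by
      intro v hv y hy z hz
      have hy1 := (adj v y).1 hy.1
      have hz1 := (adj v z).1 hz.1
      have hyS := hy.2
      have hzS := hz.2
      have hbx := hb' x
      have hxb' := G.adj_comm x b
      have hux' := hux.ne
      simp only [Set.mem_insert_iff, Set.mem_singleton_iff] at hv hyS hzS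
      grind [SimpleGraph.irrefl]
    have := h hmem u (by simp) (show x ∈ _ from ⟨hux, by simp⟩) ⟨hbu.symm, by simp⟩
    exact hxb this
  exact Set.ncard_lt_ncard hlt (Set.toFinite _)

theorem reattach_neighborSet_of_ne {V : Type*} {G : SimpleGraph V} {u a b c : V}
    (hub : u ≠ b) (hab : a ≠ b) (hcu : c ≠ u) (hca : c ≠ a) (hcb : c ≠ b) :
    (reattach G u a b).neighborSet c = G.neighborSet c := by
  ext y
  simp only [mem_neighborSet, reattach_adj G hub hab]
  grind

/-- In a tree with the second-largest number of dissociation sets, every quasi-pendant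
vertex is adjacent to at most three pendant vertices. -/
theorem pendant_neighbors_le_three (n : ℕ) (T : SimpleGraph (Fin n))
    (hT : SecondLargestTree n T) (uq : Fin n)
    (hquasi : 2 ≤ (T.neighborSet uq).ncard ∧
      ∃ w, T.Adj uq w ∧ (T.neighborSet w).ncard = 1) (s : ℕ)
    (hs : s = {w | T.Adj uq w ∧ (T.neighborSet w).ncard = 1}.ncard) :
    s ≤ 3 := by
  by_contra! hlt
  rw [hs, Nat.lt_iff_add_one_le] at hlt
  obtain ⟨A, hA, hcard⟩ := Set.exists_subset_card_eq hlt
  obtain ⟨a, b, c, d, hab, hac, had, hbc, hbd, hcd, rfl⟩ := Set.ncard_eq_four.1 hcard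
  have key : ∀ w ∈ ({a, b, c, d} : Set (Fin n)), T.Adj uq w ∧ T.neighborSet w = {uq} := by
    intro w hw
    obtain ⟨hadj, h1⟩ := hA hw
    obtain ⟨v, hv⟩ := Set.ncard_eq_one.1 h1
    have : uq = v := (Set.ext_iff.1 hv uq).1 hadj.symm
    exact ⟨hadj, this ▸ hv⟩
  obtain ⟨hua, ha⟩ := key a (by simp)
  obtain ⟨hub, hb⟩ := key b (by simp)
  obtain ⟨huc, hc⟩ := key c (by simp)
  obtain ⟨hud, hd⟩ := key d (by simp)
  have hc' := (reattach_neighborSet_of_ne (G := T) hub.ne hab huc.ne' hac.symm hbc.symm).trans hc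
  have hd' := (reattach_neighborSet_of_ne (G := T) hub.ne hab hud.ne' had.symm hbd.symm).trans hd
  have hua' : (reattach T uq a b).Adj uq a :=
    (reattach_adj T hub.ne hab uq a).2 (Or.inl ⟨hua, by grind, by grind [hub.ne]⟩)
  have htree := reattach_isTree hT.1 ha hb hab
  have hgt := dissocNum_lt_reattach ha hb hab huc hac.symm hbc.symm
  have hle := hT.2.2 _ htree ⟨_, reattach_isTree htree hc' hd' hcd,
    dissocNum_lt_reattach hc' hd' hcd hua' hac had⟩
  omega
end

section
/- Let G be a connected finite simple graph of order n ≥ 9 whose cycle-space dimension c(G) = |E(G)| − |V(G)| + 1 is at least 2 (equivalently, G has at least n + 1 edges). Then d(G) < h(n), where h(n) = 2^{n−1} + (n+9)·2^{(n−7)/2} if n is odd and h(n) = 2^{n−1} + (n+12)·2^{(n−8)/2} if n is even. -/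
open SimpleGraph

/-- `h(n) = 2^{n−1} + (n+9)·2^{(n−7)/2}` for odd `n` and
`h(n) = 2^{n−1} + (n+12)·2^{(n−8)/2}` for even `n`. -/
def hBound (n : ℕ) : ℕ :=
  if Odd n then 2 ^ (n - 1) + (n + 9) * 2 ^ ((n - 7) / 2)
  else 2 ^ (n - 1) + (n + 12) * 2 ^ ((n - 8) / 2)

/-- An upper bound for the proportion of dissociation sets in a connected graph of order `k`. -/
def densityBound : ℕ → ℚ
  | 0 | 1 | 2 => 1
  | 3 => 7 / 8
  | 4 => 13 / 16
  | 5 => 3 / 4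
  | 6 => 11 / 16
  | 7 => 21 / 32
  | 8 => 39 / 64
  | 9 => 19 / 32
  | _ => 9 / 16

/-- The weight of the neighbour of `v` in a part of size `k`: it is halved when that neighbour has
a further neighbour in its part. -/
def branchWeight (k : ℕ) : ℚ := if k ≤ 1 then 1 else 1 / 2

/-- The lists of positive integers with sum `m`. -/
def compositions : ℕ → List (List ℕ)
  | 0 => [[]]
  | m + 1 => (compositions m).flatMap fun l =>
      match l with
      | [] => [[1]]
      | a :: t => [1 :: a :: t, (a + 1) :: t]

/-- The bound on the proportion of dissociation sets avoiding a vertex whose deletion leaves parts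
of sizes `l`. -/
def prodBound (l : List ℕ) : ℚ := (l.map densityBound).prod

/-- The corresponding bound on the proportion of dissociation sets through that vertex. -/
def hubBound (l : List ℕ) (b : ℚ) : ℚ := (b + (l.map branchWeight).sum) / 2 ^ l.length

theorem mem_compositions : ∀ (m : ℕ) (l : List ℕ), (∀ k ∈ l, 1 ≤ k) → l.sum = m →
    l ∈ compositions m
  | 0, [], _, _ => by simp [compositions]
  | 0, a :: t, h, hs => by
    have := h a (by simp)
    simp at hs; omega
  | m + 1, [], _, hs => by simp at hs
  | m + 1, a :: t, h, hs => by
    have ha := h a (by simp)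
    simp only [List.sum_cons] at hs
    simp only [compositions, List.mem_flatMap]
    by_cases h1 : a = 1
    · subst h1
      refine ⟨t, mem_compositions m t (fun k hk => h k (by simp [hk])) (by omega), ?_⟩
      cases t <;> simp
    · refine ⟨(a - 1) :: t, mem_compositions m _ ?_ ?_, ?_⟩
      · intro k hk
        rcases List.mem_cons.1 hk with rfl | hk
        · omega
        · exact h k (by simp [hk])
      · simp; omega
      · simp; omega

theorem densityBound_antitone : Antitone densityBound := by
  refine antitone_nat_of_succ_le fun n => ?_
  match n with
  | 0 | 1 | 2 | 3 | 4 | 5 | 6 | 7 | 8 | 9 => norm_num [densityBound]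
  | n + 10 => exact le_rfl

theorem densityBound_nonneg (k : ℕ) : 0 ≤ densityBound k := by
  unfold densityBound
  split <;> norm_num

theorem branchWeight_antitone : Antitone branchWeight := by
  intro a b h
  unfold branchWeight
  split_ifs <;> first | omega | norm_num

theorem branchWeight_le_one (k : ℕ) : branchWeight k ≤ 1 := by
  unfold branchWeight
  split_ifs <;> norm_num

theorem exists_le_composition : ∀ (l : List ℕ) (m : ℕ), (∀ k ∈ l, 1 ≤ k) → l.length ≤ m →
    m ≤ l.sum → ∃ l', List.Forall₂ (· ≤ ·) l' l ∧ (∀ k ∈ l', 1 ≤ k) ∧ l'.sum = m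
  | [], m, _, _, hm => ⟨[], .nil, by simp, by simp at hm; simp [hm]⟩
  | a :: t, m, h, hl, hm => by
    have ht : ∀ k ∈ t, 1 ≤ k := fun k hk => h k (by simp [hk])
    have ha := h a (by simp)
    simp only [List.length_cons, List.sum_cons] at hl hm
    by_cases hs : m - 1 ≤ t.sum
    · obtain ⟨t', h1, h2, h3⟩ := exists_le_composition t (m - 1) ht (by omega) hs
      exact ⟨1 :: t', .cons ha h1, by simpa using h2, by simp [h3]; omega⟩
    · exact ⟨(m - t.sum) :: t, .cons (by omega) (List.forall₂_refl t),
        by simp only [List.mem_cons, forall_eq_or_imp]; exact ⟨by omega, ht⟩, by simp; omega⟩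

theorem prodBound_nonneg (l : List ℕ) : 0 ≤ prodBound l :=
  List.prod_nonneg fun _ hx => by
    obtain ⟨k, -, rfl⟩ := List.mem_map.1 hx
    exact densityBound_nonneg k

theorem prodBound_le_of_forall₂ {l' l : List ℕ} (h : List.Forall₂ (· ≤ ·) l' l) :
    prodBound l ≤ prodBound l' := by
  induction h with
  | nil => exact le_rfl
  | @cons a b s t hab _ ih =>
    simp only [prodBound, List.map_cons, List.prod_cons] at ih ⊢
    exact mul_le_mul (densityBound_antitone hab) ih (prodBound_nonneg t) (densityBound_nonneg a)

theorem hubBound_le_of_forall₂ {l' l : List ℕ} (h : List.Forall₂ (· ≤ ·) l' l) (b : ℚ) :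
    hubBound l b ≤ hubBound l' b := by
  unfold hubBound
  rw [h.length_eq]
  gcongr ?_ / _
  induction h with
  | nil => exact le_rfl
  | cons hab _ ih =>
    simp only [List.map_cons, List.sum_cons]
    linarith [branchWeight_antitone hab]

theorem hubBound_mono (l : List ℕ) {b c : ℚ} (h : b ≤ c) : hubBound l b ≤ hubBound l c := by
  unfold hubBound
  gcongr

theorem hubBound_le_one_eighth {l : List ℕ} (h : 6 ≤ l.length) : hubBound l 1 ≤ 1 / 8 := by
  have h1 : (l.map branchWeight).sum ≤ l.length := by
    have := List.sum_le_card_nsmul (l.map branchWeight) 1 fun x hx => by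
      obtain ⟨k, -, rfl⟩ := List.mem_map.1 hx
      exact branchWeight_le_one k
    simpa using this
  have h2 : 8 * (1 + l.length) ≤ 2 ^ l.length := by
    generalize l.length = r at h
    induction r, h using Nat.le_induction with
    | base => norm_num
    | succ n hn ih => rw [pow_succ]; omega
  have h3 : (8 * (1 + l.length) : ℚ) ≤ 2 ^ l.length := by exact_mod_cast h2
  unfold hubBound
  rw [div_le_iff₀ (by positivity)]
  linarith

set_option maxRecDepth 100000 in
theorem prodBound_add_hubBound_le : ∀ m ∈ Finset.Icc 3 9, ∀ l ∈ compositions m, 3 ≤ l.length →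
    prodBound l + hubBound l 1 ≤ 2 * densityBound (m + 1) := by
  decide +kernel

set_option maxRecDepth 100000 in
theorem min_add_hubBound_lt : ∀ m ∈ Finset.Icc 8 11, ∀ l ∈ compositions m, 3 ≤ l.length →
    min (7 / 8) (prodBound l) + hubBound l (if m = 9 ∧ 7 ∈ l then 7 / 8 else 1) <
      2 * (hBound (m + 1) / 2 ^ (m + 1)) := by
  decide +kernel

set_option maxRecDepth 100000 in
theorem min_add_hubBound_le_one : ∀ l ∈ compositions 12, 3 ≤ l.length →
    min (7 / 8) (prodBound l) + hubBound l 1 ≤ 1 := by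
  decide +kernel

theorem min_add_hubBound_le_one_of_twelve_le {l : List ℕ} (h1 : ∀ k ∈ l, 1 ≤ k)
    (hl : 3 ≤ l.length) (hs : 12 ≤ l.sum) : min (7 / 8) (prodBound l) + hubBound l 1 ≤ 1 := by
  by_cases h6 : 6 ≤ l.length
  · linarith [hubBound_le_one_eighth h6, min_le_left (7 / 8) (prodBound l)]
  · obtain ⟨l', h, h1', hs'⟩ := exists_le_composition l 12 h1 (by omega) hs
    have := min_add_hubBound_le_one l' (mem_compositions 12 l' h1' hs') (by rwa [h.length_eq])
    exact (add_le_add (min_le_min_left _ (prodBound_le_of_forall₂ h))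
      (hubBound_le_of_forall₂ h 1)).trans this

open Finset

section Density

variable {V : Type*} (G : SimpleGraph V)

open Classical in
/-- The dissociation sets of `G` contained in `A`. -/
noncomputable def dissocSets (A : Finset V) : Finset (Finset V) :=
  A.powerset.filter fun S => IsDissociation G S

/-- The proportion of subsets of `A` that are dissociation sets of `G`. -/
noncomputable def dissocDensity (A : Finset V) : ℚ := #(dissocSets G A) / 2 ^ #A

open Classical in
/-- The neighbours of `v` in `A`. -/
noncomputable def nbrs (v : V) (A : Finset V) : Finset V := A.filter (G.Adj v)

variable {G}

theorem mem_dissocSets {A S : Finset V} :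
    S ∈ dissocSets G A ↔ S ⊆ A ∧ IsDissociation G S := by
  simp [dissocSets]

theorem mem_nbrs {v w : V} {A : Finset V} : w ∈ nbrs G v A ↔ w ∈ A ∧ G.Adj v w := by
  simp [nbrs]

theorem nbrs_subset {v : V} {A : Finset V} : nbrs G v A ⊆ A := fun _ h => (mem_nbrs.1 h).1

theorem nbrs_mono {v : V} {A B : Finset V} (h : A ⊆ B) : nbrs G v A ⊆ nbrs G v B :=
  fun _ hx => mem_nbrs.2 ⟨h (mem_nbrs.1 hx).1, (mem_nbrs.1 hx).2⟩

theorem IsDissociation.mono {S T : Set V} (h : IsDissociation G T) (hST : S ⊆ T) :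
    IsDissociation G S :=
  fun v hv => (h v (hST hv)).anti (Set.inter_subset_inter_right _ hST)

theorem IsDissociation.eq_of_adj {S : Finset V} (h : IsDissociation G S) {v x y : V} (hv : v ∈ S)
    (hx : x ∈ S) (hy : y ∈ S) (hvx : G.Adj v x) (hvy : G.Adj v y) : x = y :=
  h v hv ⟨hvx, hx⟩ ⟨hvy, hy⟩

theorem dissocNum_eq [Fintype V] : dissocNum G = #(dissocSets G univ) := by
  classical
  have e : {S : Set V // IsDissociation G S} ≃ {S : Finset V // IsDissociation G (S : Set V)} :=
    (Equiv.subtypeEquiv Fintype.finsetEquivSet fun S => by simp).symm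
  rw [dissocNum, Nat.card_congr e, Nat.card_eq_fintype_card, Fintype.card_subtype]
  simp [dissocSets]

theorem dissocDensity_nonneg (A : Finset V) : 0 ≤ dissocDensity G A := by
  unfold dissocDensity; positivity

theorem dissocDensity_le_one (A : Finset V) : dissocDensity G A ≤ 1 := by
  unfold dissocDensity
  rw [div_le_one (by positivity)]
  have : #(dissocSets G A) ≤ #A.powerset := card_le_card fun S hS => by
    simpa using (mem_dissocSets.1 hS).1
  rw [card_powerset] at this
  exact_mod_cast this

variable [DecidableEq V]

theorem dissocDensity_union_le {A B : Finset V} (h : Disjoint A B) :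
    dissocDensity G (A ∪ B) ≤ dissocDensity G A * dissocDensity G B := by
  have key : #(dissocSets G (A ∪ B)) ≤ #(dissocSets G A) * #(dissocSets G B) := by
    rw [← card_product]
    refine card_le_card_of_injOn (fun S => (S ∩ A, S ∩ B)) ?_ ?_
    · intro S hS
      have hS := (mem_dissocSets.1 hS).2
      simp only [coe_product, Set.mem_prod, mem_coe, mem_dissocSets]
      exact ⟨⟨inter_subset_right, hS.mono (by simp)⟩, ⟨inter_subset_right, hS.mono (by simp)⟩⟩
    · intro S hS T hT hST
      have hS := (mem_dissocSets.1 hS).1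
      have hT := (mem_dissocSets.1 hT).1
      simp only [Prod.mk.injEq] at hST
      rw [← inter_eq_left.2 hS, ← inter_eq_left.2 hT, inter_union_distrib_left,
        inter_union_distrib_left, hST.1, hST.2]
  unfold dissocDensity
  rw [card_union_of_disjoint h, pow_add, div_mul_div_comm]
  gcongr
  exact_mod_cast key

theorem dissocDensity_anti {A B : Finset V} (h : A ⊆ B) :
    dissocDensity G B ≤ dissocDensity G A := by
  have := dissocDensity_union_le (G := G) (disjoint_sdiff (s := A) (t := B))
  rw [union_sdiff_of_subset h] at this
  exact this.trans (mul_le_of_le_one_right (dissocDensity_nonneg A) (dissocDensity_le_one _))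

theorem dissocDensity_biUnion_le (X : Finset V) (C : V → Finset V)
    (h : (X : Set V).PairwiseDisjoint C) :
    dissocDensity G (X.biUnion C) ≤ ∏ x ∈ X, dissocDensity G (C x) := by
  induction X using Finset.induction_on with
  | empty => simpa using dissocDensity_le_one (G := G) ∅
  | insert a X ha ih =>
    rw [biUnion_insert, prod_insert ha]
    have hX : (X : Set V).PairwiseDisjoint C := h.subset (by simp)
    have hd : Disjoint (C a) (X.biUnion C) := by
      rw [disjoint_biUnion_right]
      intro i hi
      exact h (by simp) (by simp [hi]) (by rintro rfl; exact ha hi)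
    exact (dissocDensity_union_le hd).trans
      (mul_le_mul_of_nonneg_left (ih hX) (dissocDensity_nonneg _))

theorem dissocSets_insert_card {v : V} {A : Finset V} (hv : v ∉ A) :
    #(dissocSets G (insert v A)) =
      #(dissocSets G A) + #(A.powerset.filter fun S => insert v S ∈ dissocSets G (insert v A)) := by
  classical
  conv_lhs => rw [dissocSets, powerset_insert, filter_union]
  rw [card_union_of_disjoint]
  · rw [filter_image, card_image_of_injOn]
    · refine congrArg₂ _ rfl (congrArg card ?_)
      ext S
      simp only [mem_filter, mem_powerset, mem_dissocSets]
      constructor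
      · rintro ⟨h1, h2⟩
        exact ⟨h1, insert_subset_insert _ h1, h2⟩
      · rintro ⟨h1, -, h2⟩
        exact ⟨h1, h2⟩
    · intro S hS T hT hST
      simp only [coe_filter, mem_powerset, Set.mem_ofPred_eq] at hS hT
      have h1 : v ∉ S := fun h => hv (hS.1 h)
      have h2 : v ∉ T := fun h => hv (hT.1 h)
      simpa [erase_insert h1, erase_insert h2] using congrArg (fun U => U.erase v) hST
  · rw [Finset.disjoint_left]
    intro S hS hS'
    simp only [mem_filter, mem_powerset, mem_image] at hS hS'
    obtain ⟨⟨T, -, rfl⟩, -⟩ := hS'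
    exact hv (hS.1 (mem_insert_self _ _))

/-- Bound on the number of dissociation sets through `v`: such a set contains at most one
vertex `x` of `X`, and then avoids the other neighbours of `x`. -/
theorem card_dissocSets_through_le {v : V} {A X Y : Finset V} (hX : X ⊆ nbrs G v A)
    (hv : v ∉ A) (hY : ∀ x ∈ Y, ∃ w ∈ A \ X, G.Adj x w) :
    (#(A.powerset.filter fun S => insert v S ∈ dissocSets G (insert v A)) : ℚ) ≤
      2 ^ #(A \ X) * (dissocDensity G (A \ X) + ∑ x ∈ X, if x ∈ Y then 1 / 2 else 1) := by
  classical
  choose! w hw hxw using hY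
  let R : V → Finset V := fun x => if x ∈ Y then (A \ X).erase (w x) else A \ X
  have hsub : (A.powerset.filter fun S => insert v S ∈ dissocSets G (insert v A)) ⊆
      dissocSets G (A \ X) ∪ X.biUnion fun x => (R x).powerset.image (insert x) := by
    intro S hS
    simp only [mem_filter, mem_powerset, mem_dissocSets] at hS
    obtain ⟨hSA, -, hS⟩ := hS
    by_cases hSX : Disjoint S X
    · refine mem_union_left _ (mem_dissocSets.2 ⟨subset_sdiff.2 ⟨hSA, hSX⟩, hS.mono ?_⟩)
      exact_mod_cast subset_insert v S
    · obtain ⟨x, hxS, hxX⟩ := not_disjoint_iff.1 hSX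
      have hvx := (mem_nbrs.1 (hX hxX)).2
      refine mem_union_right _ (mem_biUnion.2 ⟨x, hxX, mem_image.2 ⟨S.erase x, ?_,
        insert_erase hxS⟩⟩)
      have h1 : S.erase x ⊆ A \ X := by
        intro y hy
        obtain ⟨hyx, hyS⟩ := mem_erase.1 hy
        refine mem_sdiff.2 ⟨hSA hyS, fun hyX => hyx ?_⟩
        exact hS.eq_of_adj (mem_insert_self v S) (mem_insert_of_mem hyS) (mem_insert_of_mem hxS)
          (mem_nbrs.1 (hX hyX)).2 hvx
      rw [mem_powerset]
      by_cases hxY : x ∈ Y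
      · simp only [R, if_pos hxY]
        refine subset_erase.2 ⟨h1, fun hwS => ?_⟩
        have hwS := (mem_erase.1 hwS).2
        have := hS.eq_of_adj (mem_insert_of_mem hxS) (mem_insert_self v S)
          (mem_insert_of_mem hwS) hvx.symm (hxw x hxY)
        exact hv (this ▸ hSA hwS)
      · simpa only [R, if_neg hxY] using h1
  have hR : ∀ x ∈ X, ((#((R x).powerset.image (insert x)) : ℕ) : ℚ) ≤
      2 ^ #(A \ X) * (if x ∈ Y then 1 / 2 else 1) := by
    intro x _
    have h1 : #((R x).powerset.image (insert x)) ≤ 2 ^ #(R x) := by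
      simpa using card_image_le (s := (R x).powerset) (f := insert x)
    have h2 : ((2 : ℚ) ^ #(R x)) = 2 ^ #(A \ X) * (if x ∈ Y then 1 / 2 else 1) := by
      by_cases hxY : x ∈ Y
      · simp only [R, if_pos hxY]
        rw [← card_erase_add_one (hw x hxY), pow_succ]
        ring
      · simp only [R, if_neg hxY, mul_one]
    rw [← h2]
    exact_mod_cast h1
  have h0 : (#(dissocSets G (A \ X)) : ℚ) = 2 ^ #(A \ X) * dissocDensity G (A \ X) := by
    unfold dissocDensity
    field_simp
  calc _ ≤ ((#(dissocSets G (A \ X)) +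
        ∑ x ∈ X, #((R x).powerset.image (insert x)) : ℕ) : ℚ) := by
        exact_mod_cast (card_le_card hsub).trans
          ((card_union_le _ _).trans (add_le_add_right card_biUnion_le _))
    _ ≤ _ := by
        push_cast
        rw [h0, mul_add, mul_sum]
        gcongr with x hx
        exact hR x hx

theorem dissocDensity_le {v : V} {A X Y : Finset V} (hX : X ⊆ nbrs G v A)
    (hv : v ∈ A) (hY : ∀ x ∈ Y, ∃ w ∈ A.erase v \ X, G.Adj x w) :
    dissocDensity G A ≤ (dissocDensity G (A.erase v) +
      (dissocDensity G (A.erase v \ X) + ∑ x ∈ X, if x ∈ Y then 1 / 2 else 1) / 2 ^ #X) / 2 := by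
  have hXA : X ⊆ A.erase v := fun x hx =>
    mem_erase.2 ⟨(mem_nbrs.1 (hX hx)).2.ne', (mem_nbrs.1 (hX hx)).1⟩
  have hX' : X ⊆ nbrs G v (A.erase v) := fun x hx => mem_nbrs.2 ⟨hXA hx, (mem_nbrs.1 (hX hx)).2⟩
  have h1 := card_dissocSets_through_le hX' (notMem_erase v A) hY
  have h2 := dissocSets_insert_card (G := G) (notMem_erase v A)
  set M := #((A.erase v).powerset.filter fun S =>
    insert v S ∈ dissocSets G (insert v (A.erase v)))
  rw [insert_erase hv] at h2
  set Q := dissocDensity G (A.erase v \ X) + ∑ x ∈ X, if x ∈ Y then (1 / 2 : ℚ) else 1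
  have h3 : #A = #(A.erase v \ X) + #X + 1 := by
    rw [card_sdiff_add_card_eq_card hXA, card_erase_add_one hv]
  have h4 : #(A.erase v) = #(A.erase v \ X) + #X := (card_sdiff_add_card_eq_card hXA).symm
  have h5 : dissocDensity G A = (dissocDensity G (A.erase v) +
      (M : ℚ) / 2 ^ #(A.erase v \ X) / 2 ^ #X) / 2 := by
    unfold dissocDensity
    rw [h2, h3, h4]
    push_cast
    rw [pow_add, pow_add]
    field_simp
  rw [h5]
  gcongr
  rw [div_le_iff₀ (by positivity), mul_comm]
  exact h1

end Density

section Grown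

/-- `Grown G v A` means that `A` arises from `{v}` by successively adding vertices adjacent to
earlier ones; equivalently, `v ∈ A` and `A` induces a connected subgraph of `G`. -/
inductive Grown {V : Type*} [DecidableEq V] (G : SimpleGraph V) (v : V) : Finset V → Prop
  | single : Grown G v {v}
  | grow {A : Finset V} {u w : V} : Grown G v A → u ∈ A → w ∉ A → G.Adj u w →
      Grown G v (insert w A)

variable {V : Type*} [DecidableEq V] {G : SimpleGraph V}

namespace Grown

theorem root_mem {v : V} {A : Finset V} (h : Grown G v A) : v ∈ A := by
  induction h with
  | single => simp
  | grow _ _ _ _ ih => exact mem_insert_of_mem ih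

theorem insert_root {u w : V} {A : Finset V} (h : Grown G u A) (hw : w ∉ A) (hwu : G.Adj w u) :
    Grown G w (insert w A) := by
  induction h with
  | single =>
    rw [pair_comm]
    exact .grow .single (mem_singleton_self w) (by simpa using hwu.ne') hwu
  | @grow A x y hA hx hy hxy ih =>
    rw [insert_comm]
    have hw' : w ≠ y ∧ w ∉ A := by simpa using hw
    exact .grow (ih hw'.2) (mem_insert_of_mem hx) (by simp [hw'.1.symm, hy]) hxy

theorem reroot {a b : V} {A : Finset V} (h : Grown G a A) (hb : b ∈ A) : Grown G b A := by
  induction h generalizing b with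
  | single => rw [mem_singleton.1 hb]; exact .single
  | @grow A x y hA hx hy hxy ih =>
    rcases mem_insert.1 hb with rfl | hb
    · exact (ih hx).insert_root hy hxy.symm
    · exact .grow (ih hb) hx hy hxy

theorem exists_insert {v : V} {A : Finset V} (h : Grown G v A) (h2 : 2 ≤ #A) :
    ∃ u w B, Grown G v B ∧ u ∈ B ∧ w ∉ B ∧ G.Adj u w ∧ A = insert w B := by
  cases h with
  | single => simp at h2
  | @grow B u w hB hu hw huw => exact ⟨u, w, B, hB, hu, hw, huw, rfl⟩

theorem exists_adj {v : V} {A : Finset V} (h : Grown G v A) (h2 : 2 ≤ #A) :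
    ∃ w ∈ A, G.Adj v w := by
  induction h with
  | single => simp at h2
  | @grow A u w hA hu hw huw ih =>
    by_cases hA2 : 2 ≤ #A
    · obtain ⟨x, hx, hvx⟩ := ih hA2
      exact ⟨x, mem_insert_of_mem hx, hvx⟩
    · have huv : u = v := card_le_one.1 (by omega) u hu v hA.root_mem
      exact ⟨w, mem_insert_self w A, huv ▸ huw⟩

theorem exists_path {v : V} {A : Finset V} (h : Grown G v A) (h3 : 3 ≤ #A) :
    ∃ a ∈ A, ∃ b ∈ A, ∃ c ∈ A, a ≠ c ∧ G.Adj b a ∧ G.Adj b c := by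
  obtain ⟨u, w, B, hB, hu, hw, huw, rfl⟩ := h.exists_insert (by omega)
  rw [card_insert_of_notMem hw] at h3
  obtain ⟨y, hy, huy⟩ := (hB.reroot hu).exists_adj (by omega)
  exact ⟨w, mem_insert_self w B, u, mem_insert_of_mem hu, y, mem_insert_of_mem hy,
    fun h => hw (h ▸ hy), huw, huy⟩

theorem of_path {a b c : V} (hac : a ≠ c) (ha : G.Adj b a) (hc : G.Adj b c) :
    Grown G b {a, c, b} :=
  .grow (.grow .single (mem_singleton_self b) (by simpa using hc.ne') hc) (by simp)
    (by simp [hac, ha.ne']) ha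

theorem univ_of_connected [Fintype V] (h : G.Connected) (v : V) : Grown G v univ := by
  classical
  obtain ⟨A, hA⟩ := (Set.toFinite {A : Finset V | Grown G v A}).exists_maximal ⟨{v}, .single⟩
  have hcl : ∀ u w, u ∈ A → G.Adj u w → w ∈ A := by
    intro u w hu huw
    by_contra hw
    exact hw (hA.2 (hA.1.grow hu hw huw) (subset_insert w A) (mem_insert_self w A))
  have : A = univ := eq_univ_iff_forall.2 fun w => by
    have := (G.reachable_iff_reflTransGen v w).1 (h.preconnected v w)
    induction this with
    | refl => exact hA.1.root_mem
    | tail _ hxy ih => exact hcl _ _ ih hxy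
  exact this ▸ hA.1

end Grown

/-- A partition of `A \ {v}` into connected parts `C x`, each containing a chosen
neighbour `x ∈ X` of `v`. -/
structure IsStarPartition (G : SimpleGraph V) (v : V) (A X : Finset V) (C : V → Finset V) :
    Prop where
  subset : X ⊆ nbrs G v A
  grown : ∀ x ∈ X, Grown G x (C x)
  disj : (X : Set V).PairwiseDisjoint C
  cover : X.biUnion C = A.erase v

theorem Grown.exists_isStarPartition {v : V} {A : Finset V} (h : Grown G v A) :
    ∃ C, IsStarPartition G v A (nbrs G v A) C := by
  induction h with
  | single =>
    have : nbrs G v {v} = ∅ := by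
      ext x
      simp only [mem_nbrs, mem_singleton, notMem_empty, iff_false, not_and]
      rintro rfl
      exact G.loopless.irrefl x
    exact ⟨fun _ => ∅, by simp [this], by simp [this], by simp [this], by simp [this]⟩
  | @grow A u w hA hu hw huw ih =>
    obtain ⟨C, hC⟩ := ih
    have hwv : w ≠ v := fun h => hw (h ▸ hA.root_mem)
    have hCA : ∀ x ∈ nbrs G v A, C x ⊆ A := fun x hx =>
      (subset_biUnion_of_mem C hx).trans (hC.cover ▸ erase_subset v A)
    by_cases hvw : G.Adj v w
    · have hX : nbrs G v (insert w A) = insert w (nbrs G v A) := by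
        ext x
        simp only [mem_nbrs, mem_insert]
        constructor
        · rintro ⟨rfl | h, h'⟩ <;> simp [*]
        · rintro (rfl | h) <;> simp [*]
      have hwX : w ∉ nbrs G v A := fun h => hw (nbrs_subset h)
      have hne : ∀ x ∈ nbrs G v A, x ≠ w := fun x hx h => hwX (h ▸ hx)
      refine ⟨Function.update C w {w}, subset_rfl, ?_, ?_, ?_⟩
      · intro x hx
        rcases mem_insert.1 (hX ▸ hx) with rfl | hx
        · simpa using Grown.single
        · rw [Function.update_of_ne (hne x hx)]
          exact hC.grown x hx
      · rw [hX, coe_insert, Set.pairwiseDisjoint_insert_of_notMem (by simpa using hwX)]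
        refine ⟨fun x hx y hy hxy => ?_, fun x hx => ?_⟩
        · simp only [Function.onFun, Function.update_of_ne (hne x hx),
            Function.update_of_ne (hne y hy)]
          exact hC.disj hx hy hxy
        · rw [Function.update_self, Function.update_of_ne (hne x hx),
            Finset.disjoint_singleton_left]
          exact fun h => hw (hCA x hx h)
      · rw [hX, biUnion_insert, Function.update_self, erase_insert_of_ne hwv, ← hC.cover,
          insert_eq]
        congr 1
        exact biUnion_congr rfl fun x hx => Function.update_of_ne (hne x hx) _ _
    · have hX : nbrs G v (insert w A) = nbrs G v A := by
        ext x
        simp only [mem_nbrs, mem_insert]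
        constructor
        · rintro ⟨rfl | h, h'⟩
          · exact absurd h' hvw
          · exact ⟨h, h'⟩
        · exact fun h => ⟨.inr h.1, h.2⟩
      have huv : u ≠ v := by rintro rfl; exact hvw huw
      have hu' : u ∈ (nbrs G v A).biUnion C := hC.cover ▸ mem_erase.2 ⟨huv, hu⟩
      obtain ⟨x, hx, hux⟩ := mem_biUnion.1 hu'
      have hwC : ∀ y ∈ nbrs G v A, w ∉ C y := fun y hy h => hw (hCA y hy h)
      refine ⟨Function.update C x (insert w (C x)), subset_rfl, ?_, ?_, ?_⟩ <;> rw [hX]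
      · intro y hy
        by_cases hyx : y = x
        · subst hyx
          rw [Function.update_self]
          exact (hC.grown y hy).grow hux (hwC y hy) huw
        · rw [Function.update_of_ne hyx]
          exact hC.grown y hy
      · intro y hy z hz hyz
        have := hC.disj hy hz hyz
        simp only [Function.onFun] at this ⊢
        by_cases hyx : y = x
        · subst hyx
          rw [Function.update_self, Function.update_of_ne hyz.symm,
            Finset.disjoint_insert_left]
          exact ⟨hwC z hz, this⟩
        · rw [Function.update_of_ne hyx]
          by_cases hzx : z = x
          · subst hzx
            rw [Function.update_self, Finset.disjoint_insert_right]
            exact ⟨hwC y hy, this⟩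
          · rwa [Function.update_of_ne hzx]
      · rw [erase_insert_of_ne hwv, ← hC.cover]
        ext z
        simp only [mem_biUnion, mem_insert]
        constructor
        · rintro ⟨y, hy, hz⟩
          by_cases hyx : y = x
          · subst hyx
            rw [Function.update_self, mem_insert] at hz
            exact hz.imp_right fun hz => ⟨y, hy, hz⟩
          · rw [Function.update_of_ne hyx] at hz
            exact .inr ⟨y, hy, hz⟩
        · rintro (rfl | ⟨y, hy, hz⟩)
          · exact ⟨x, hx, by simp⟩
          · refine ⟨y, hy, ?_⟩
            by_cases hyx : y = x
            · subst hyx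
              simp [hz]
            · rwa [Function.update_of_ne hyx]

namespace IsStarPartition

variable {v : V} {A X : Finset V} {C : V → Finset V}

theorem part_subset (h : IsStarPartition G v A X C) {x : V} (hx : x ∈ X) : C x ⊆ A.erase v :=
  h.cover ▸ subset_biUnion_of_mem C hx

theorem eq_of_mem (h : IsStarPartition G v A X C) {x y : V} (hx : x ∈ X) (hy : y ∈ X)
    (hyx : y ∈ C x) : y = x := by
  by_contra hne
  exact Finset.disjoint_left.1 (h.disj hy hx hne) (h.grown y hy).root_mem hyx

theorem one_le_card (h : IsStarPartition G v A X C) {x : V} (hx : x ∈ X) : 1 ≤ #(C x) :=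
  card_pos.2 ⟨x, (h.grown x hx).root_mem⟩

theorem sum_card (h : IsStarPartition G v A X C) (hv : v ∈ A) :
    ∑ x ∈ X, #(C x) + 1 = #A := by
  rw [← card_biUnion h.disj, h.cover, card_erase_add_one hv]

theorem density_erase_le (h : IsStarPartition G v A X C) :
    dissocDensity G (A.erase v) ≤ ∏ x ∈ X, dissocDensity G (C x) :=
  h.cover ▸ dissocDensity_biUnion_le X C h.disj

theorem density_le (h : IsStarPartition G v A X C) (hv : v ∈ A) :
    dissocDensity G A ≤ (dissocDensity G (A.erase v) +
      (dissocDensity G (A.erase v \ X) + ∑ x ∈ X, branchWeight #(C x)) / 2 ^ #X) / 2 := by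
  have key := dissocDensity_le (Y := X.filter fun x => 2 ≤ #(C x)) h.subset hv ?_
  · refine key.trans_eq ?_
    congr 4
    refine sum_congr rfl fun x hx => ?_
    simp only [mem_filter, hx, true_and, branchWeight]
    split_ifs <;> first | rfl | omega
  · intro x hx
    obtain ⟨hx, h2⟩ := mem_filter.1 hx
    obtain ⟨w, hw, hxw⟩ := (h.grown x hx).exists_adj h2
    exact ⟨w, mem_sdiff.2 ⟨h.part_subset hx hw,
      fun hwX => hxw.ne (h.eq_of_mem hx hwX hw).symm⟩, hxw⟩

end IsStarPartition

/-- In a connected graph of maximum degree at most two, some vertex splits the graph into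
connected parts of sizes `k` and `#A - 1 - k`. -/
theorem Grown.exists_path_split {r : V} {A : Finset V} (h : Grown G r A)
    (hdeg : ∀ v ∈ A, #(nbrs G v A) ≤ 2) {k : ℕ} (hk : 1 ≤ k) (hkA : k + 2 ≤ #A) :
    ∃ v ∈ A, ∃ b c C, b ≠ c ∧ IsStarPartition G v A {b, c} C ∧ #(C b) = k := by
  have state : ∀ k, 1 ≤ k → k + 1 ≤ #A → ∃ B ⊆ A, ∃ u v, Grown G u B ∧ #B = k ∧ G.Adj v u ∧
      Grown G v (A \ B) ∧ #(nbrs G v (A \ B)) ≤ 1 := by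
    intro k hk
    induction k, hk using Nat.le_induction with
    | base =>
      intro hA
      obtain ⟨u, w, B, hB, hu, hw, huw, rfl⟩ := h.exists_insert hA
      have hd : insert w B \ {w} = B := by
        rw [insert_sdiff_of_mem _ (mem_singleton_self w), sdiff_singleton_eq_erase,
          erase_eq_of_notMem hw]
      refine ⟨{w}, by simp, w, u, .single, by simp, huw, ?_, ?_⟩ <;> rw [hd]
      · exact hB.reroot hu
      · have h1 := hdeg u (mem_insert_of_mem hu)
        have h2 : insert w (nbrs G u B) ⊆ nbrs G u (insert w B) :=
          insert_subset (mem_nbrs.2 ⟨mem_insert_self w B, huw⟩) (nbrs_mono (subset_insert w B))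
        have h3 := card_le_card h2
        rw [card_insert_of_notMem fun h => hw (nbrs_subset h)] at h3
        omega
    | succ k hk ih =>
      intro hA
      obtain ⟨B, hBA, u, v, hB, hBk, hvu, hR, hRv⟩ := ih (by omega)
      have hcard := card_sdiff_add_card_eq_card hBA
      obtain ⟨y, hy, hvy⟩ := hR.exists_adj (by omega)
      obtain ⟨C, hC⟩ := hR.exists_isStarPartition
      have hX : nbrs G v (A \ B) = {y} := by
        refine (eq_of_subset_of_card_le ?_ (by simpa using hRv)).symm
        simpa using mem_nbrs.2 ⟨hy, hvy⟩
      have hvR := mem_sdiff.1 hR.root_mem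
      have hcov := hC.cover
      have hgr := hC.grown
      rw [hX, singleton_biUnion] at hcov
      rw [hX] at hgr
      have hyR := hgr y (mem_singleton_self y)
      rw [hcov] at hyR
      have hdiff : A \ insert v B = (A \ B).erase v := by
        rw [sdiff_insert]
      refine ⟨insert v B, insert_subset hvR.1 hBA, v, y, hB.insert_root hvR.2 hvu,
        by rw [card_insert_of_notMem hvR.2, hBk], hvy.symm, hdiff ▸ hyR, ?_⟩
      have h1 := hdeg y (mem_sdiff.1 hy).1
      have h2 : insert v (nbrs G y (A \ insert v B)) ⊆ nbrs G y A :=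
        insert_subset (mem_nbrs.2 ⟨hvR.1, hvy.symm⟩) (nbrs_mono sdiff_subset)
      have h3 := card_le_card h2
      rw [card_insert_of_notMem fun h =>
        (mem_sdiff.1 (nbrs_subset h)).2 (mem_insert_self v B)] at h3
      omega
  obtain ⟨B, hBA, u, v, hB, hBk, hvu, hR, hRv⟩ := state k hk (by omega)
  have hcard := card_sdiff_add_card_eq_card hBA
  obtain ⟨y, hy, hvy⟩ := hR.exists_adj (by omega)
  obtain ⟨C, hC⟩ := hR.exists_isStarPartition
  have hX : nbrs G v (A \ B) = {y} := by
    refine (eq_of_subset_of_card_le ?_ (by simpa using hRv)).symm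
    simpa using mem_nbrs.2 ⟨hy, hvy⟩
  have hvR := mem_sdiff.1 hR.root_mem
  have hcov := hC.cover
  have hgr := hC.grown
  rw [hX, singleton_biUnion] at hcov
  rw [hX] at hgr
  have hyR := hgr y (mem_singleton_self y)
  have hyB := (mem_sdiff.1 hy).2
  have huy : u ≠ y := fun h => hyB (h ▸ hB.root_mem)
  refine ⟨v, hvR.1, u, y, Function.update C u B, huy, ⟨?_, ?_, ?_, ?_⟩, by simpa using hBk⟩
  · rw [insert_subset_iff, singleton_subset_iff]
    exact ⟨mem_nbrs.2 ⟨hBA hB.root_mem, hvu⟩, mem_nbrs.2 ⟨(mem_sdiff.1 hy).1, hvy⟩⟩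
  · intro x hx
    rcases mem_insert.1 hx with rfl | hx
    · simpa using hB
    · rw [mem_singleton.1 hx, Function.update_of_ne huy.symm]
      exact hyR
  · have hd : Disjoint B (C y) := by
      rw [hcov]
      exact disjoint_sdiff.mono_right (erase_subset v _)
    rw [coe_pair, Set.pairwiseDisjoint_insert]
    simpa [Set.pairwiseDisjoint_singleton, huy, Function.onFun,
      Function.update_of_ne huy.symm] using hd
  · rw [biUnion_insert, singleton_biUnion, Function.update_self,
      Function.update_of_ne huy.symm, hcov, ← erase_eq_of_notMem hvR.2, ← erase_union_distrib,
      erase_eq_of_notMem hvR.2, union_sdiff_of_subset hBA]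

end Grown

section Bounds

variable {V : Type*}

/-- The sizes of the parts of a star partition. -/
noncomputable def partSizes (X : Finset V) (C : V → Finset V) : List ℕ :=
  X.toList.map fun x => #(C x)

theorem partSizes_length (X : Finset V) (C : V → Finset V) : (partSizes X C).length = #X := by
  simp [partSizes]

variable [DecidableEq V] {G : SimpleGraph V}

namespace IsStarPartition

variable {v : V} {A X : Finset V} {C : V → Finset V}

theorem one_le_of_mem_partSizes (h : IsStarPartition G v A X C) {k : ℕ} (hk : k ∈ partSizes X C) :
    1 ≤ k := by
  obtain ⟨x, hx, rfl⟩ := List.mem_map.1 hk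
  exact h.one_le_card (mem_toList.1 hx)

theorem partSizes_sum (h : IsStarPartition G v A X C) (hv : v ∈ A) :
    (partSizes X C).sum + 1 = #A := by
  rw [partSizes, sum_map_toList, h.sum_card hv]

theorem partSizes_mem_compositions (h : IsStarPartition G v A X C) (hv : v ∈ A) :
    partSizes X C ∈ compositions (#A - 1) :=
  mem_compositions _ _ (fun _ => h.one_le_of_mem_partSizes) (by have := h.partSizes_sum hv; omega)

theorem density_le_hubBound (h : IsStarPartition G v A X C) (hv : v ∈ A) :
    dissocDensity G A ≤ (dissocDensity G (A.erase v) +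
      hubBound (partSizes X C) (dissocDensity G (A.erase v \ X))) / 2 := by
  have := h.density_le hv
  rwa [hubBound, partSizes_length, partSizes, List.map_map, sum_map_toList]

theorem density_erase_le_prodBound (h : IsStarPartition G v A X C)
    (hC : ∀ x ∈ X, dissocDensity G (C x) ≤ densityBound #(C x)) :
    dissocDensity G (A.erase v) ≤ prodBound (partSizes X C) := by
  rw [prodBound, partSizes, List.map_map, prod_map_toList]
  exact h.density_erase_le.trans
    (prod_le_prod (fun _ _ => dissocDensity_nonneg _) fun x hx => hC x hx)

/-- The path case: two parts. -/
theorem density_le_of_pair {b c : V} (h : IsStarPartition G v A {b, c} C) (hv : v ∈ A)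
    (hbc : b ≠ c) : dissocDensity G A ≤ (dissocDensity G (C b) * dissocDensity G (C c) +
      (dissocDensity G (A.erase v \ {b, c}) + (branchWeight #(C b) + branchWeight #(C c))) / 4)
        / 2 := by
  have h1 := h.density_le hv
  have h2 := h.density_erase_le
  rw [prod_pair hbc] at h2
  rw [sum_pair hbc, card_pair hbc] at h1
  norm_num at h1 ⊢
  linarith

theorem card_add_card_of_pair {b c : V} (h : IsStarPartition G v A {b, c} C) (hv : v ∈ A)
    (hbc : b ≠ c) : #(C b) + #(C c) + 1 = #A := by
  rw [← h.sum_card hv, sum_pair hbc]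

end IsStarPartition

theorem Grown.density_le_of_path {r : V} {A : Finset V} (h : Grown G r A)
    (hdeg : ∀ v ∈ A, #(nbrs G v A) ≤ 2) (h3 : 3 ≤ #A) (h10 : #A ≤ 10)
    (ih : ∀ x C, Grown G x C → #C < #A → dissocDensity G C ≤ densityBound #C) :
    dissocDensity G A ≤ densityBound #A := by
  obtain ⟨v, hv, b, c, C, hbc, hC, hk⟩ :=
    h.exists_path_split hdeg (k := (#A - 1) / 2) (by omega) (by omega)
  have hcard := hC.card_add_card_of_pair hv hbc
  have hb := ih b (C b) (hC.grown b (by simp)) (by omega)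
  have hc := ih c (C c) (hC.grown c (by simp)) (by omega)
  have hle := hC.density_le_of_pair hv hbc
  have hbc' := mul_le_mul hb hc (dissocDensity_nonneg _) (densityBound_nonneg _)
  have h1 := dissocDensity_le_one (G := G) (A.erase v \ {b, c})
  have hcard' : #(C c) = #A - 1 - (#A - 1) / 2 := by omega
  rw [hk, hcard'] at hbc' hle
  generalize #A = n at *
  interval_cases n <;> norm_num [densityBound, branchWeight] at * <;> linarith

theorem Grown.density_le {r : V} {A : Finset V} (h : Grown G r A) :
    dissocDensity G A ≤ densityBound #A := by
  induction hn : #A using Nat.strong_induction_on generalizing r A with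
  | _ n ih =>
  subst hn
  have ih' : ∀ x C, Grown G x C → #C < #A → dissocDensity G C ≤ densityBound #C :=
    fun x C hC hlt => ih _ hlt hC rfl
  by_cases h3 : #A < 3
  · have : densityBound #A = 1 := by
      generalize #A = n at h3
      interval_cases n <;> rfl
    exact this ▸ dissocDensity_le_one A
  by_cases h10 : #A ≤ 10
  · by_cases hdeg : ∀ v ∈ A, #(nbrs G v A) ≤ 2
    · exact h.density_le_of_path hdeg (by omega) h10 ih'
    · push Not at hdeg
      obtain ⟨v, hv, hd⟩ := hdeg
      obtain ⟨C, hC⟩ := (h.reroot hv).exists_isStarPartition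
      have hA : #A - 1 + 1 = #A := by omega
      have h4 : #(nbrs G v A) + 1 ≤ #A := by
        have : nbrs G v A ⊆ A.erase v := fun x hx =>
          mem_erase.2 ⟨(mem_nbrs.1 hx).2.ne', nbrs_subset hx⟩
        have := card_le_card this
        rw [card_erase_of_mem hv] at this
        omega
      have key := prodBound_add_hubBound_le (#A - 1) (Finset.mem_Icc.2 (by omega)) _
        (hC.partSizes_mem_compositions hv) (by rw [partSizes_length]; omega)
      rw [hA] at key
      have h1 := hC.density_le_hubBound hv
      have h2 := hC.density_erase_le_prodBound fun x hx => ih' x _ (hC.grown x hx) <| by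
        have := card_le_card (hC.part_subset hx)
        rw [card_erase_of_mem hv] at this
        omega
      have h5 := hubBound_mono (partSizes (nbrs G v A) C)
        (dissocDensity_le_one (G := G) (A.erase v \ nbrs G v A))
      linarith
  · obtain ⟨u, w, B, hB, hu, hw, huw, rfl⟩ := h.exists_insert (by omega)
    rw [card_insert_of_notMem hw] at h10 ih' ⊢
    refine (dissocDensity_anti (subset_insert w B)).trans ((ih' _ _ hB (by omega)).trans_eq ?_)
    obtain ⟨k, hk⟩ := Nat.exists_eq_add_of_le (show 10 ≤ #B by omega)
    rw [hk, add_comm 10, add_right_comm]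
    rfl

/-- Deleting the root of a large part with few neighbours leaves a connected triple. -/
theorem IsStarPartition.density_sdiff_le {v : V} {A X : Finset V} {C : V → Finset V}
    (h : IsStarPartition G v A X C) (hv : v ∈ A) {x : V} (hx : x ∈ X)
    (hcard : 2 * #(nbrs G x A) ≤ #(C x)) : dissocDensity G (A.erase v \ X) ≤ 7 / 8 := by
  obtain ⟨D, hD⟩ := (h.grown x hx).exists_isStarPartition
  have hsub := h.part_subset hx
  have hins : insert v (nbrs G x (C x)) ⊆ nbrs G x A :=
    insert_subset (mem_nbrs.2 ⟨hv, (mem_nbrs.1 (h.subset hx)).2.symm⟩)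
      (nbrs_mono (hsub.trans (erase_subset v A)))
  have h1 := card_le_card hins
  rw [card_insert_of_notMem fun hv' => (mem_erase.1 (hsub (nbrs_subset hv'))).1 rfl] at h1
  have hsum := hD.sum_card (h.grown x hx).root_mem
  obtain ⟨y, hy, hy3⟩ : ∃ y ∈ nbrs G x (C x), 2 < #(D y) := by
    by_contra! hcon
    have := sum_le_card_nsmul _ _ _ hcon
    rw [smul_eq_mul] at this
    omega
  have hDy : D y ⊆ A.erase v \ X := by
    intro z hz
    have hz := mem_erase.1 (hD.part_subset hy hz)
    exact mem_sdiff.2 ⟨hsub hz.2, fun hzX => hz.1 (h.eq_of_mem hx hzX hz.2)⟩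
  exact (dissocDensity_anti hDy).trans
    ((hD.grown y hy).density_le.trans (densityBound_antitone hy3))

end Bounds

section Main

theorem two_pow_lt_hBound (n : ℕ) : 2 ^ (n - 1) < hBound n := by
  unfold hBound
  split_ifs <;> simp

theorem lt_hBound_of_density_le_half {n d : ℕ} (hn : 9 ≤ n) (h : (d : ℚ) / 2 ^ n ≤ 1 / 2) :
    d < hBound n := by
  refine lt_of_le_of_lt ?_ (two_pow_lt_hBound n)
  rw [div_le_iff₀ (by positivity)] at h
  have h2 : (2 : ℚ) ^ n = 2 ^ (n - 1) * 2 := by rw [← pow_succ, Nat.sub_add_cancel (by omega)]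
  rw [h2] at h
  have : (d : ℚ) ≤ 2 ^ (n - 1) := by linarith
  exact_mod_cast this

/-- The arithmetic for a graph with a vertex `v` of degree `r` such that `G - v` is a matching
covering all `u` non-neighbours of `v`. -/
theorem hub_lt_hBound {n r u : ℕ} (hn : 9 ≤ n) (hru : r + u + 1 = n) (hr : n + 3 ≤ 2 * r) :
    (1 + (1 + (r - u / 2)) / 2 ^ r) / 2 < (hBound n : ℚ) / 2 ^ n := by
  have key : ∀ j : ℕ, j + 1 ≤ 2 ^ j := fun j => j.lt_two_pow_self
  have hpow : (2 : ℚ) ^ n = 2 * 2 ^ r * 2 ^ u := by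
    rw [← hru, pow_succ, pow_add]
    ring
  suffices hs : 2 ^ n + 2 ^ u * (2 + 2 * r - u) < (2 * hBound n : ℚ) by
    rw [div_lt_div_iff₀ (by norm_num) (by positivity)]
    have : (1 + (1 + ((r : ℚ) - u / 2)) / 2 ^ r) * 2 ^ n =
        2 ^ n + 2 ^ u * (2 + 2 * r - u) := by
      rw [hpow]
      field_simp
      ring
    rw [this]
    linarith
  have hn2 : (2 : ℚ) ^ n = 2 * 2 ^ (n - 1) := by
    rw [← pow_succ', Nat.sub_add_cancel (by omega)]
  rw [hn2]
  unfold hBound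
  rcases Nat.even_or_odd' n with ⟨k, rfl | rfl⟩
  · rw [if_neg (by simp)]
    obtain ⟨j, hj⟩ := Nat.exists_eq_add_of_le (show u + 3 ≤ k by omega)
    have hk : (2 * k - 8) / 2 + 1 = u + j := by omega
    have hp : (2 : ℚ) * 2 ^ ((2 * k - 8) / 2) = 2 ^ u * 2 ^ j := by
      rw [← pow_succ', hk, pow_add]
    have hr' : (r : ℚ) = u + 5 + 2 * j := by
      have : r = u + 5 + 2 * j := by omega
      exact_mod_cast this
    have hk' : (k : ℚ) = u + 3 + j := by exact_mod_cast hj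
    have h1 : ((2 : ℚ) + 2 * r - u) < 2 ^ j * (2 * k + 12) := by
      have : (j + 1 : ℚ) ≤ 2 ^ j := by exact_mod_cast key j
      have hu : (0 : ℚ) ≤ u := by positivity
      have hj : (0 : ℚ) ≤ j := by positivity
      rw [hr', hk']
      nlinarith [mul_nonneg hj hu]
    push_cast
    have hu : (0 : ℚ) < 2 ^ u := by positivity
    nlinarith [mul_lt_mul_of_pos_left h1 hu]
  · rw [if_pos (by simp), show 2 * k + 1 - 7 = 2 * k - 6 by omega]
    obtain ⟨j, hj⟩ := Nat.exists_eq_add_of_le (show u + 2 ≤ k by omega)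
    have hk : (2 * k - 6) / 2 + 1 = u + j := by omega
    have hp : (2 : ℚ) * 2 ^ ((2 * k - 6) / 2) = 2 ^ u * 2 ^ j := by
      rw [← pow_succ', hk, pow_add]
    have hr' : (r : ℚ) = u + 4 + 2 * j := by
      have : r = u + 4 + 2 * j := by omega
      exact_mod_cast this
    have hk' : (k : ℚ) = u + 2 + j := by exact_mod_cast hj
    have h1 : ((2 : ℚ) + 2 * r - u) < 2 ^ j * (2 * k + 1 + 9) := by
      have : (j + 1 : ℚ) ≤ 2 ^ j := by exact_mod_cast key j
      have hu : (0 : ℚ) ≤ u := by positivity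
      have hj : (0 : ℚ) ≤ j := by positivity
      rw [hr', hk']
      nlinarith [mul_nonneg hj hu]
    push_cast
    have hu : (0 : ℚ) < 2 ^ u := by positivity
    nlinarith [mul_lt_mul_of_pos_left h1 hu]

variable {V : Type*} [Fintype V] [DecidableEq V] {G : SimpleGraph V}

/-- A connected graph with at least `n + 1` edges in which `G - v` has maximum degree at most
one. -/
theorem density_lt_of_hub (hc : G.Connected) (h9 : 9 ≤ Fintype.card V)
    (hcyc : Fintype.card V + 1 ≤ G.edgeSet.ncard) {v : V}
    (hv : ∀ b ≠ v, #(nbrs G b (univ.erase v)) ≤ 1) :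
    dissocDensity G univ < hBound (Fintype.card V) / 2 ^ Fintype.card V := by
  classical
  obtain ⟨C, hC⟩ := (Grown.univ_of_connected hc v).exists_isStarPartition
  have hdeg : ∀ b, #(nbrs G b univ) = G.degree b := fun b => by
    rw [← G.card_neighborFinset_eq_degree]
    congr 1
    ext x
    simp [mem_nbrs]
  set X := nbrs G v univ
  have hXd : #X = G.degree v := hdeg v
  have hsplit : ∀ b, #(nbrs G b univ) ≤ #(nbrs G b (univ.erase v)) + if b ∈ X then 1 else 0 := by
    intro b
    split_ifs with hb
    · refine (card_le_card (t := insert v (nbrs G b (univ.erase v))) fun x hx => ?_).trans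
        (card_insert_le _ _)
      by_cases hxv : x = v
      · simp [hxv]
      · exact mem_insert_of_mem (mem_nbrs.2 ⟨by simp [hxv], (mem_nbrs.1 hx).2⟩)
    · refine card_le_card fun x hx => mem_nbrs.2 ⟨mem_erase.2 ⟨?_, mem_univ x⟩, (mem_nbrs.1 hx).2⟩
      rintro rfl
      exact hb (mem_nbrs.2 ⟨mem_univ b, (mem_nbrs.1 hx).2.symm⟩)
  have hedge : Fintype.card V + 1 ≤ #G.edgeFinset := by
    rwa [Set.ncard_eq_toFinset_card'] at hcyc
  have hsum : ∑ b, G.degree b ≤ #X + ((Fintype.card V - 1) + #X) := by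
    rw [← add_sum_erase univ _ (mem_univ v), ← hXd]
    gcongr
    calc ∑ b ∈ univ.erase v, G.degree b
        ≤ ∑ b ∈ univ.erase v, (1 + if b ∈ X then 1 else 0) := by
          refine sum_le_sum fun b hb => ?_
          rw [← hdeg b]
          exact (hsplit b).trans (by gcongr; exact hv b (mem_erase.1 hb).1)
      _ ≤ _ := by
          rw [sum_add_distrib, sum_boole]
          simp only [sum_const, card_erase_of_mem (mem_univ v), card_univ, smul_eq_mul, mul_one,
            Nat.cast_id, add_le_add_iff_left]
          exact card_le_card fun x hx => (mem_filter.1 hx).2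
  rw [G.sum_degrees_eq_twice_card_edges] at hsum
  have hcard2 : ∀ x ∈ X, #(C x) ≤ 2 := by
    intro x hx
    by_contra! h3
    obtain ⟨a, ha, b, hb, c, hcC, hac, hba, hbc⟩ := (hC.grown x hx).exists_path h3
    have hsub := hC.part_subset hx
    exact hac (card_le_one.1 (hv b (mem_erase.1 (hsub hb)).1) a (mem_nbrs.2 ⟨hsub ha, hba⟩) c
      (mem_nbrs.2 ⟨hsub hcC, hbc⟩))
  have hw : ∑ x ∈ X, branchWeight #(C x) = ∑ x ∈ X, (3 / 2 - (#(C x) : ℚ) / 2) := by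
    refine sum_congr rfl fun x hx => ?_
    have h1 := hC.one_le_card hx
    have h2 := hcard2 x hx
    generalize #(C x) = m at h1 h2
    interval_cases m <;> norm_num [branchWeight]
  have hle := hC.density_le (mem_univ v)
  have hcardC := hC.sum_card (mem_univ v)
  rw [card_univ] at hcardC
  have hXC : #X ≤ ∑ x ∈ X, #(C x) := by
    simpa using card_nsmul_le_sum X (fun x => #(C x)) 1 fun x hx => hC.one_le_card hx
  obtain ⟨u, hu⟩ := Nat.exists_eq_add_of_le hXC
  have hu' : (∑ x ∈ X, (#(C x) : ℚ)) = #X + u := by exact_mod_cast hu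
  rw [hw, sum_sub_distrib, sum_const, nsmul_eq_mul, ← sum_div, hu'] at hle
  refine lt_of_le_of_lt (hle.trans ?_) (hub_lt_hBound h9 (r := #X) (u := u) (by omega) (by omega))
  gcongr ?_ / _
  refine add_le_add (dissocDensity_le_one _) ?_
  gcongr ?_ / _
  linarith [dissocDensity_le_one (G := G) (univ.erase v \ X)]

/-- The case of a path or cycle. -/
theorem density_lt_of_degree_le_two (hc : G.Connected) (h9 : 9 ≤ Fintype.card V)
    (hdeg : ∀ v, #(nbrs G v univ) ≤ 2) :
    dissocDensity G univ < hBound (Fintype.card V) / 2 ^ Fintype.card V ∨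
      dissocDensity G univ ≤ 1 / 2 := by
  obtain ⟨r⟩ := hc.nonempty
  obtain ⟨v, hv, b, c, C, hbc, hC, hk⟩ :=
    (Grown.univ_of_connected hc r).exists_path_split (fun v _ => hdeg v)
      (k := min 6 ((#(univ : Finset V) - 1) / 2)) (by rw [card_univ]; omega)
      (by rw [card_univ]; omega)
  have hcard := hC.card_add_card_of_pair hv hbc
  rw [card_univ] at hk hcard
  have hb := (hC.grown b (by simp)).density_le
  have hc' := (hC.grown c (by simp)).density_le
  have hle := hC.density_le_of_pair hv hbc
  have hbc' := mul_le_mul hb hc' (dissocDensity_nonneg _) (densityBound_nonneg _)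
  have h1 := hC.density_sdiff_le hv (x := b) (by simp)
    ((Nat.mul_le_mul_left 2 (hdeg b)).trans (by omega))
  have hcc : #(C c) = Fintype.card V - 1 - #(C b) := by omega
  generalize Fintype.card V = n at *
  by_cases h13 : n < 13
  · left
    rw [hcc, hk] at hbc' hle
    interval_cases n <;> norm_num [densityBound, branchWeight, hBound, Nat.odd_iff] at * <;>
      linarith
  · right
    have hb6 : #(C b) = 6 := by omega
    have := densityBound_antitone (show 6 ≤ #(C c) by omega)
    have hw : branchWeight #(C c) ≤ 1 / 2 :=
      (branchWeight_antitone (show 6 ≤ #(C c) by omega)).trans (by norm_num [branchWeight])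
    rw [hb6] at hbc' hle
    norm_num [densityBound, branchWeight] at *
    linarith

theorem density_lt_of_three_le_degree (hc : G.Connected) (h9 : 9 ≤ Fintype.card V) {v : V}
    (hv : 3 ≤ #(nbrs G v univ)) (hmax : ∀ w, #(nbrs G w univ) ≤ #(nbrs G v univ))
    (h78 : dissocDensity G (univ.erase v) ≤ 7 / 8) :
    dissocDensity G univ < hBound (Fintype.card V) / 2 ^ Fintype.card V ∨
      dissocDensity G univ ≤ 1 / 2 := by
  obtain ⟨C, hC⟩ := (Grown.univ_of_connected hc v).exists_isStarPartition
  have hle := hC.density_le_hubBound (mem_univ v)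
  have hmin := le_min h78
    (hC.density_erase_le_prodBound fun x hx => (hC.grown x hx).density_le)
  have hlen := partSizes_length (nbrs G v univ) C
  have hsum := hC.partSizes_sum (mem_univ v)
  have hcomp := hC.partSizes_mem_compositions (mem_univ v)
  rw [card_univ] at hsum hcomp
  by_cases h13 : Fintype.card V < 13
  · left
    have hbeta : dissocDensity G (univ.erase v \ nbrs G v univ) ≤
        if Fintype.card V - 1 = 9 ∧ 7 ∈ partSizes (nbrs G v univ) C then 7 / 8 else 1 := by
      split_ifs with h
      · obtain ⟨x, hx, hx7⟩ := List.mem_map.1 h.2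
        rw [mem_toList] at hx
        refine hC.density_sdiff_le (mem_univ v) hx ?_
        have h3 : #(nbrs G v univ) ≤ 3 := by
          have h1 := hC.sum_card (mem_univ v)
          rw [← add_sum_erase _ _ hx, card_univ] at h1
          have h2 := card_nsmul_le_sum ((nbrs G v univ).erase x) (fun x => #(C x)) 1
            fun y hy => hC.one_le_card (mem_erase.1 hy).2
          rw [card_erase_of_mem hx, smul_eq_mul, mul_one] at h2
          omega
        have := hmax x
        omega
      · exact dissocDensity_le_one _
    have key := min_add_hubBound_lt (Fintype.card V - 1) (Finset.mem_Icc.2 (by omega)) _ hcomp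
      (by omega)
    rw [Nat.sub_add_cancel (by omega)] at key
    have := hubBound_mono (partSizes (nbrs G v univ) C) hbeta
    linarith
  · right
    have := min_add_hubBound_le_one_of_twelve_le (fun _ => hC.one_le_of_mem_partSizes)
      (by omega) (by omega)
    have := hubBound_mono (partSizes (nbrs G v univ) C)
      (dissocDensity_le_one (G := G) (univ.erase v \ nbrs G v univ))
    linarith

theorem density_erase_le_of_path {v a b c : V} (ha : a ≠ v) (hb : b ≠ v) (hcv : c ≠ v)
    (hac : a ≠ c) (hba : G.Adj b a) (hbc : G.Adj b c) :
    dissocDensity G (univ.erase v) ≤ 7 / 8 := by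
  have hsub : ({a, c, b} : Finset V) ⊆ univ.erase v := by
    simp [insert_subset_iff, ha, hb, hcv]
  have h3 : #({a, c, b} : Finset V) = 3 := card_eq_three.2 ⟨a, c, b, hac, hba.ne', hbc.ne', rfl⟩
  have := (Grown.of_path hac hba hbc).density_le
  rw [h3] at this
  exact (dissocDensity_anti hsub).trans this

end Main

/-- A connected graph of order `n ≥ 9` with cycle-space dimension at least 2
(equivalently, at least `n + 1` edges) has fewer than `h(n)` dissociation sets. -/
theorem cycleDim_ge_two_lt_hBound {V : Type*} [Fintype V] (G : SimpleGraph V) (n : ℕ)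
    (hn : Fintype.card V = n) (h9 : 9 ≤ n) (hc : G.Connected)
    (hcyc : n + 1 ≤ G.edgeSet.ncard) :
    dissocNum G < hBound n := by
  classical
  subst hn
  suffices h : dissocDensity G univ < hBound (Fintype.card V) / 2 ^ Fintype.card V ∨
      dissocDensity G univ ≤ 1 / 2 by
    rw [dissocNum_eq]
    rw [dissocDensity, card_univ] at h
    rcases h with h | h
    · rw [div_lt_div_iff_of_pos_right (by positivity)] at h
      exact_mod_cast h
    · exact lt_hBound_of_density_le_half h9 h
  by_cases hhub : ∃ v, ∀ b ≠ v, #(nbrs G b (univ.erase v)) ≤ 1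
  · obtain ⟨v, hv⟩ := hhub
    exact .inl (density_lt_of_hub hc h9 hcyc hv)
  obtain ⟨r⟩ := hc.nonempty
  obtain ⟨v, -, hv⟩ := exists_max_image univ (fun v => #(nbrs G v univ)) ⟨r, mem_univ r⟩
  by_cases h2 : #(nbrs G v univ) ≤ 2
  · exact density_lt_of_degree_le_two hc h9 fun w => (hv w (mem_univ w)).trans h2
  push Not at hhub
  obtain ⟨b, hb, hb1⟩ := hhub v
  obtain ⟨a, ha, c, hcb, hac⟩ := one_lt_card.1 hb1
  rw [mem_nbrs, mem_erase] at ha hcb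
  exact density_lt_of_three_le_degree hc h9 (by omega) (fun w => hv w (mem_univ w))
    (density_erase_le_of_path ha.1.1 hb hcb.1.1 hac ha.2 hcb.2)
end
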